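/- Suppose A_1, …, A_r are stable and A_{r+1}, …, A_k are unstable (1 ≤ r < k), and suppose ρ_2 := max{‖P_j⁻¹P_i‖ : (i,j) ∈ E(G), i ∈ {r+1,…,k}} < 1. If τ > max{ln‖P_j⁻¹P_i‖ / λ_i : (i,j) ∈ E(G), i ∈ {1,…,r}} and 0 < η < min{−ln‖P_j⁻¹P_i‖ / μ_i : (i,j) ∈ E(G), i ∈ {r+1,…,k}}, then the switched system is asymptotically stable for every signal σ ∈ S_G(τ, η). -/

import Mathlib

open Matrix Filter Topology Finset

attribute [local instance] Classical.propDecidable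

noncomputable section

/-- The spectral (ℓ² operator) norm of a complex square matrix. -/
def sNorm {n : ℕ} (M : Matrix (Fin n) (Fin n) ℂ) : ℝ :=
  ‖Matrix.toEuclideanCLM (𝕜 := ℂ) M‖

/-- The spectral (ℓ² operator) norm of a real square matrix. -/
def sNormR {n : ℕ} (M : Matrix (Fin n) (Fin n) ℝ) : ℝ :=
  ‖Matrix.toEuclideanCLM (𝕜 := ℝ) M‖

/-- The ordered product `exp(A_{σ_m}(t_m - t_{m-1})) ⋯ exp(A_{σ_1} t_1)` of the switched
system (0-based: `flow A t v m = exp((t m - t (m-1)) • A (v (m-1))) * ⋯ * exp((t 1 - t 0) • A (v 0))`). -/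
def flow {n k : ℕ} (A : Fin k → Matrix (Fin n) (Fin n) ℝ)
    (t : ℕ → ℝ) (v : ℕ → Fin k) : ℕ → Matrix (Fin n) (Fin n) ℝ
  | 0 => 1
  | m + 1 => NormedSpace.exp ((t (m + 1) - t m) • A (v m)) * flow A t v m

/-- Piecewise evaluation: the value `f m` on the interval `[t m, t (m+1))`. -/
def pc {α : Type*} (t : ℕ → ℝ) (f : ℕ → α) (d : α) (s : ℝ) : α :=
  if h : ∃ m, t m ≤ s ∧ s < t (m + 1) then f h.choose else d

/-- The solution of the switched system `x' = A_{σ(t)} x`, `x(0) = x0`: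
for `s ∈ [t m, t (m+1))`, `x(s) = exp((s - t m) • A (v m)) * flow A t v m * x0`. -/
def sol {n k : ℕ} (A : Fin k → Matrix (Fin n) (Fin n) ℝ)
    (t : ℕ → ℝ) (v : ℕ → Fin k) (x0 : EuclideanSpace ℝ (Fin n)) (s : ℝ) :
    EuclideanSpace ℝ (Fin n) :=
  pc t (fun m => Matrix.toEuclideanCLM (𝕜 := ℝ)
    (NormedSpace.exp ((s - t m) • A (v m)) * flow A t v m) x0) 0 s

/-- A `G`-admissible switching signal: `t 0 = 0`, strictly increasing switching times tending
to infinity, and consecutive vertices joined by edges of `G`.  Here `v m` is the vertex active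
on `[t m, t (m+1))` (i.e. `v m = σ_{m+1}` in 1-based notation). -/
def Admissible {k : ℕ} (E : Set (Fin k × Fin k)) (t : ℕ → ℝ) (v : ℕ → Fin k) : Prop :=
  t 0 = 0 ∧ StrictMono t ∧ Tendsto t atTop atTop ∧ ∀ m, (v m, v (m + 1)) ∈ E

/-- A real matrix is stable if all its (complex) eigenvalues have negative real part. -/
def MStable {n : ℕ} (M : Matrix (Fin n) (Fin n) ℝ) : Prop :=
  ∀ z ∈ spectrum ℂ (M.map (Complex.ofReal)), z.re < 0

/-- A real matrix is unstable if some eigenvalue has positive real part and no eigenvalue has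
zero real part. -/
def MUnstable {n : ℕ} (M : Matrix (Fin n) (Fin n) ℝ) : Prop :=
  (∃ z ∈ spectrum ℂ (M.map (Complex.ofReal)), 0 < z.re) ∧
    ∀ z ∈ spectrum ℂ (M.map (Complex.ofReal)), z.re ≠ 0

/-- `a` is the maximum of the real parts of the eigenvalues of `M`. -/
def MaxRe {n : ℕ} (M : Matrix (Fin n) (Fin n) ℝ) (a : ℝ) : Prop :=
  IsGreatest (Complex.re '' spectrum ℂ (M.map (Complex.ofReal))) a

/-- `M = P D P⁻¹` with `P` invertible and `D` diagonal (diagonalizability over `ℂ`). -/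
def Diagonalized {n : ℕ} (M : Matrix (Fin n) (Fin n) ℝ)
    (P D : Matrix (Fin n) (Fin n) ℂ) : Prop :=
  IsUnit P ∧ D.IsDiag ∧ M.map (Complex.ofReal) = P * D * P⁻¹

/-- Asymptotic stability of the switched system for the given signal. -/
def AsympStable {n k : ℕ} (A : Fin k → Matrix (Fin n) (Fin n) ℝ)
    (t : ℕ → ℝ) (v : ℕ → Fin k) : Prop :=
  ∀ x0 : EuclideanSpace ℝ (Fin n), Tendsto (fun s => ‖sol A t v x0 s‖) atTop (𝓝 0)

/-- Membership in the class `S_G(τ, η)`: dwell time at least `τ` in the stable subsystems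
(indices `< r`), flee time at most `η` in the unstable subsystems (indices `≥ r`). -/
def InSG {k : ℕ} (r : ℕ) (τ η : ℝ) (t : ℕ → ℝ) (v : ℕ → Fin k) : Prop :=
  ∀ m, ((v m).1 < r → τ ≤ t (m + 1) - t m) ∧ (r ≤ (v m).1 → t (m + 1) - t m ≤ η)

end

lemma sNorm_mul_le {n : ℕ} (M N : Matrix (Fin n) (Fin n) ℂ) :
    sNorm (M * N) ≤ sNorm M * sNorm N := by
  unfold sNorm
  rw [map_mul]
  exact norm_mul_le _ _

lemma sNorm_nonneg {n : ℕ} (M : Matrix (Fin n) (Fin n) ℂ) : 0 ≤ sNorm M := norm_nonneg _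

lemma sNorm_diagonal_le {n : ℕ} (d : Fin n → ℂ) (c : ℝ) (hc : 0 ≤ c) (h : ∀ i, ‖d i‖ ≤ c) :
    sNorm (Matrix.diagonal d) ≤ c := by
  unfold sNorm
  have h1 := Matrix.l2_opNorm_diagonal (𝕜 := ℂ) d
  rw [← Matrix.l2_opNorm_toEuclideanCLM] at h1
  have h2 : ‖d‖ ≤ c := (pi_norm_le_iff_of_nonneg hc).2 h
  rw [← h1] at h2
  exact h2

lemma map_exp_ofReal {n : ℕ} (M : Matrix (Fin n) (Fin n) ℝ) :
    (NormedSpace.exp M).map Complex.ofReal = NormedSpace.exp (M.map Complex.ofReal) := by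
  let _ : NormedRing (Matrix (Fin n) (Fin n) ℝ) := Matrix.linftyOpNormedRing
  let _ : NormedAlgebra ℝ (Matrix (Fin n) (Fin n) ℝ) := Matrix.linftyOpNormedAlgebra
  let _ : NormedAlgebra ℚ (Matrix (Fin n) (Fin n) ℝ) := NormedAlgebra.restrictScalars ℚ ℝ _
  let _ : NormedRing (Matrix (Fin n) (Fin n) ℂ) := Matrix.linftyOpNormedRing
  exact NormedSpace.map_exp (Complex.ofRealHom.mapMatrix (m := Fin n))
    (Continuous.matrix_map continuous_id Complex.continuous_ofReal) M

lemma real_apply_le {n : ℕ} (M : Matrix (Fin n) (Fin n) ℝ) (x : EuclideanSpace ℝ (Fin n)) :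
    ‖Matrix.toEuclideanCLM (𝕜 := ℝ) M x‖ ≤ sNorm (M.map Complex.ofReal) * ‖x‖ := by
  have key : ∀ y : EuclideanSpace ℝ (Fin n),
      ‖(WithLp.toLp 2 (fun i => ((y i : ℝ) : ℂ)) : EuclideanSpace ℂ (Fin n))‖ = ‖y‖ := by
    intro y
    simp [EuclideanSpace.norm_eq]
  rw [← key, ← key x]
  have : (WithLp.toLp 2 (fun i => (((Matrix.toEuclideanCLM (𝕜 := ℝ) M x) i : ℝ) : ℂ)) :
      EuclideanSpace ℂ (Fin n)) = Matrix.toEuclideanCLM (𝕜 := ℂ) (M.map Complex.ofReal)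
        (WithLp.toLp 2 (fun i => ((x i : ℝ) : ℂ))) := by
    rw [Matrix.toEuclideanCLM_toLp]
    ext i
    simp [Matrix.ofLp_toEuclideanCLM, Matrix.mulVec, dotProduct]
  rw [this]
  exact ContinuousLinearMap.le_opNorm _ _

lemma diag_re_le {n : ℕ} {M : Matrix (Fin n) (Fin n) ℝ} {P D : Matrix (Fin n) (Fin n) ℂ}
    (h : Diagonalized M P D) {c : ℝ} (hc : MaxRe M c) (i : Fin n) : (D i i).re ≤ c := by
  obtain ⟨⟨u, rfl⟩, hD, hM⟩ := h
  apply hc.2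
  refine ⟨D i i, ?_, rfl⟩
  rw [hM, ← Matrix.coe_units_inv, spectrum.units_conjugate, ← hD.diagonal_diag,
    _root_.spectrum_diagonal]
  exact ⟨i, by simp⟩

/-- The conjugated exponential factor. -/
lemma exp_factor {n : ℕ} {M : Matrix (Fin n) (Fin n) ℝ} {P D : Matrix (Fin n) (Fin n) ℂ}
    (h : Diagonalized M P D) {c : ℝ} (hc : MaxRe M c) (s : ℝ) (hs : 0 ≤ s) :
    ∃ F : Matrix (Fin n) (Fin n) ℂ, sNorm F ≤ Real.exp (c * s) ∧
      (NormedSpace.exp (s • M)).map Complex.ofReal = P * F * P⁻¹ := by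
  have hre := diag_re_le h hc
  obtain ⟨hP, hD, hM⟩ := h
  refine ⟨NormedSpace.exp ((s : ℂ) • D), ?_, ?_⟩
  · rw [← hD.diagonal_diag, ← Matrix.diagonal_smul, Matrix.exp_diagonal]
    refine sNorm_diagonal_le _ _ (Real.exp_pos _).le fun i => ?_
    rw [Pi.coe_exp, ← Complex.exp_eq_exp_ℂ, Complex.norm_exp]
    apply Real.exp_le_exp.2
    simp
    nlinarith [hre i]
  · rw [map_exp_ofReal, ← Matrix.exp_conj _ _ hP]
    congr 1
    have : (s • M).map Complex.ofReal = (s : ℂ) • M.map Complex.ofReal := by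
      ext i j; simp
    rw [this, hM]
    simp

/-- if `ρ₂ := max{‖P_j⁻¹P_i‖ : (i,j) ∈ E, i unstable} < 1`,
`τ > max{ln‖P_j⁻¹P_i‖/λ_i : (i,j) ∈ E, i stable}` and
`0 < η < min{−ln‖P_j⁻¹P_i‖/μ_i : (i,j) ∈ E, i unstable}`, then the switched system is
asymptotically stable for every signal in `S_G(τ, η)`. -/
theorem stability_of_contracting_unstable_edges {n k : ℕ} (E : Set (Fin k × Fin k))
    (r : ℕ) (hr : 1 ≤ r) (hrk : r < k)
    (A : Fin k → Matrix (Fin n) (Fin n) ℝ) (P D : Fin k → Matrix (Fin n) (Fin n) ℂ)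
    (hdiag : ∀ i, Diagonalized (A i) (P i) (D i))
    (hstab : ∀ i : Fin k, i.1 < r → MStable (A i))
    (hunst : ∀ i : Fin k, r ≤ i.1 → MUnstable (A i))
    (lam mu : Fin k → ℝ)
    (hlam : ∀ i : Fin k, i.1 < r → MaxRe (A i) (-(lam i)))
    (hmu : ∀ i : Fin k, r ≤ i.1 → MaxRe (A i) (mu i))
    (hρ₂ : ∀ i j : Fin k, (i, j) ∈ E → r ≤ i.1 → sNorm ((P j)⁻¹ * P i) < 1)
    (τ η : ℝ) (hτ : 0 < τ) (hη : 0 < η)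
    (hτ' : ∀ i j : Fin k, (i, j) ∈ E → i.1 < r →
      Real.log (sNorm ((P j)⁻¹ * P i)) / lam i < τ)
    (hη' : ∀ i j : Fin k, (i, j) ∈ E → r ≤ i.1 →
      η < -(Real.log (sNorm ((P j)⁻¹ * P i)) / mu i))
    (t : ℕ → ℝ) (v : ℕ → Fin k) (hadm : Admissible E t v) (hsg : InSG r τ η t v) :
    AsympStable A t v := by
  obtain ⟨ht0, hmono, htop, hE⟩ := hadm
  -- unified growth rate
  set c : Fin k → ℝ := fun i => if i.1 < r then -(lam i) else mu i with hcdef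
  have hc : ∀ i, MaxRe (A i) (c i) := by
    intro i
    by_cases h : i.1 < r
    · simpa [hcdef, h] using hlam i h
    · simpa [hcdef, h] using hmu i (not_lt.1 h)
  have hlampos : ∀ i : Fin k, i.1 < r → 0 < lam i := by
    intro i h
    obtain ⟨z, hz, hz2⟩ := (hlam i h).1
    have := hstab i h z hz
    linarith
  have hmupos : ∀ i : Fin k, r ≤ i.1 → 0 < mu i := by
    intro i h
    obtain ⟨⟨z, hz, hz2⟩, -⟩ := hunst i h
    exact lt_of_lt_of_le hz2 ((hmu i h).2 ⟨z, hz, rfl⟩)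
  set T : Fin k → ℝ := fun i => if i.1 < r then τ else η with hTdef
  have hstep : ∀ m, c (v m) * (t (m + 1) - t m) ≤ c (v m) * T (v m) := by
    intro m
    by_cases h : (v m).1 < r
    · have := (hsg m).1 h
      simp only [hcdef, hTdef, h, if_true]
      nlinarith [hlampos _ h]
    · have := (hsg m).2 (not_lt.1 h)
      simp only [hcdef, hTdef, h, if_false]
      exact mul_le_mul_of_nonneg_left this (hmupos _ (not_lt.1 h)).le
  have hcontr : ∀ i j, (i, j) ∈ E → sNorm ((P j)⁻¹ * P i) * Real.exp (c i * T i) < 1 := by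
    intro i j hij
    rcases (sNorm_nonneg ((P j)⁻¹ * P i)).eq_or_lt with h0 | h0
    · rw [← h0]; simp
    · rw [← Real.exp_log h0, ← Real.exp_add, Real.exp_lt_one_iff]
      by_cases h : i.1 < r
      · have := hτ' i j hij h
        rw [div_lt_iff₀ (hlampos i h)] at this
        simp only [hcdef, hTdef, h, if_true]
        linarith
      · have := hη' i j hij (not_lt.1 h)
        rw [← neg_div, lt_div_iff₀ (hmupos i (not_lt.1 h))] at this
        simp only [hcdef, hTdef, h, if_false]
        linarith
  obtain ⟨q, hq0, hq1, hq⟩ : ∃ q : ℝ, 0 < q ∧ q < 1 ∧ ∀ i j, (i, j) ∈ E →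
      sNorm ((P j)⁻¹ * P i) * Real.exp (c i * T i) ≤ q := by
    have h1 : ∀ᶠ q in 𝓝[<] (1 : ℝ), ∀ i j, (i, j) ∈ E →
        sNorm ((P j)⁻¹ * P i) * Real.exp (c i * T i) ≤ q := by
      refine eventually_all.2 fun i => eventually_all.2 fun j => ?_
      by_cases hij : (i, j) ∈ E
      · have := Ioo_mem_nhdsLT (hcontr i j hij)
        filter_upwards [this] with q hq _ using hq.1.le
      · exact Eventually.of_forall fun q h => absurd h hij
    have h2 : ∀ᶠ q in 𝓝[<] (1 : ℝ), q ∈ Set.Ioo (0 : ℝ) 1 := Ioo_mem_nhdsLT one_pos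
    obtain ⟨q, ha, hb⟩ := (h1.and h2).exists
    exact ⟨q, hb.1, hb.2, ha⟩
  have hmapmul : ∀ M N : Matrix (Fin n) (Fin n) ℝ,
      (M * N).map Complex.ofReal = M.map Complex.ofReal * N.map Complex.ofReal :=
    fun M N => Matrix.map_mul (f := Complex.ofRealHom)
  -- decay at switching times
  set C : ℝ := sNorm ((P (v 0))⁻¹ * (flow A t v 0).map Complex.ofReal) with hC
  have hdecay : ∀ m, sNorm ((P (v m))⁻¹ * (flow A t v m).map Complex.ofReal) ≤ q ^ m * C := by
    intro m
    induction m with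
    | zero => simp [hC]
    | succ m ih =>
      obtain ⟨F, hF, hFe⟩ := exp_factor (hdiag (v m)) (hc (v m)) (t (m + 1) - t m)
        (sub_nonneg.2 (hmono (Nat.lt_succ_self m)).le)
      have heq : (P (v (m + 1)))⁻¹ * (flow A t v (m + 1)).map Complex.ofReal =
          (((P (v (m + 1)))⁻¹ * P (v m)) * F) *
            ((P (v m))⁻¹ * (flow A t v m).map Complex.ofReal) := by
        rw [flow, hmapmul, hFe]
        simp only [Matrix.mul_assoc]
      rw [heq]
      have h1 : sNorm (((P (v (m + 1)))⁻¹ * P (v m)) * F) ≤ q :=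
        calc _ ≤ sNorm ((P (v (m + 1)))⁻¹ * P (v m)) * sNorm F := sNorm_mul_le _ _
          _ ≤ sNorm ((P (v (m + 1)))⁻¹ * P (v m)) * Real.exp (c (v m) * T (v m)) :=
            mul_le_mul_of_nonneg_left (hF.trans (Real.exp_le_exp.2 (hstep m))) (sNorm_nonneg _)
          _ ≤ q := hq _ _ (hE m)
      calc _ ≤ _ := sNorm_mul_le _ _
        _ ≤ q * (q ^ m * C) := mul_le_mul h1 ih (sNorm_nonneg _) hq0.le
        _ = q ^ (m + 1) * C := by ring
  -- uniform bound on the intervals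
  set K : ℝ := ∑ i, sNorm (P i) * Real.exp (|c i| * η) with hK
  have hKle : ∀ i, sNorm (P i) * Real.exp (|c i| * η) ≤ K := fun i =>
    Finset.single_le_sum (f := fun i => sNorm (P i) * Real.exp (|c i| * η))
      (fun j _ => mul_nonneg (sNorm_nonneg _) (Real.exp_pos _).le) (Finset.mem_univ i)
  have hinter : ∀ m s, t m ≤ s → s < t (m + 1) → sNorm ((NormedSpace.exp ((s - t m) • A (v m)) *
      flow A t v m).map Complex.ofReal) ≤ K * (q ^ m * C) := by
    intro m s hs1 hs2
    obtain ⟨F, hF, hFe⟩ := exp_factor (hdiag (v m)) (hc (v m)) (s - t m) (sub_nonneg.2 hs1)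
    have hF' : sNorm F ≤ Real.exp (|c (v m)| * η) := by
      refine hF.trans (Real.exp_le_exp.2 ?_)
      by_cases h : (v m).1 < r
      · have h1 : c (v m) * (s - t m) ≤ 0 := by
          simp only [hcdef, h, if_true]
          nlinarith [hlampos _ h]
        exact h1.trans (by positivity)
      · have := (hsg m).2 (not_lt.1 h)
        exact mul_le_mul (le_abs_self _) (by linarith) (by linarith) (abs_nonneg _)
    rw [hmapmul, hFe, Matrix.mul_assoc]
    calc _ ≤ _ := sNorm_mul_le _ _
      _ ≤ K * (q ^ m * C) := by
        refine mul_le_mul ?_ (hdecay m) (sNorm_nonneg _) ((mul_nonneg (sNorm_nonneg _) (Real.exp_pos _).le).trans (hKle (v m)))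
        exact (sNorm_mul_le _ _).trans
          ((mul_le_mul_of_nonneg_left hF' (sNorm_nonneg _)).trans (hKle (v m)))
  intro x0
  have hC0 : 0 ≤ C := sNorm_nonneg _
  have hK0 : 0 ≤ K := (mul_nonneg (sNorm_nonneg _) (Real.exp_pos _).le).trans (hKle (v 0))
  have hlim : Tendsto (fun m : ℕ => K * (q ^ m * C) * ‖x0‖) atTop (𝓝 0) := by
    have := (((tendsto_pow_atTop_nhds_zero_of_lt_one hq0.le hq1).mul_const C).const_mul K).mul_const ‖x0‖
    simpa using this
  rw [Metric.tendsto_atTop]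
  intro ε hε
  obtain ⟨N, hN⟩ := (hlim.eventually (gt_mem_nhds hε)).exists_forall_of_atTop
  refine ⟨t N, fun s hs => ?_⟩
  rw [Real.dist_eq, sub_zero, abs_norm]
  unfold sol pc
  split_ifs with h
  · obtain ⟨h1, h2⟩ := h.choose_spec
    have hNm : N ≤ h.choose := by
      have : t N < t (h.choose + 1) := lt_of_le_of_lt hs h2
      exact Nat.lt_succ_iff.1 (hmono.lt_iff_lt.1 this)
    refine lt_of_le_of_lt ?_ (hN _ hNm)
    exact (real_apply_le _ _).trans
      (mul_le_mul_of_nonneg_right (hinter _ s h1 h2) (norm_nonneg _))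
  · simpa using hε
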